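/- Let P be a Gibbs random field. Then for each t ∈ ℤ^d there exists a set of boundary conditions Y_t ⊆ X^{ℤ^d∖{t}} with P{ω : the restriction of ω to ℤ^d∖{t} lies in Y_t} = 1 such that for EVERY filtration F' = (Λ'_n): Y_t ⊆ 𝒳_t(F'); for every x̄ ∈ Y_t and x ∈ X the limit lim_{n→∞} g_t^{x̄_{Λ'_n∖{t}}}(x) exists, is positive, and does not depend on the choice of filtration; and the convergence is uniform with respect to x̄ ∈ Y_t. -/

import Mathlib

open MeasureTheory Filter Topology

noncomputable section

/-- Sites of the lattice `ℤ^d`. -/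
abbrev Site (d : ℕ) := Fin d → ℤ

/-- Configurations on the whole lattice. -/
abbrev Config (d : ℕ) (X : Type*) := Site d → X

variable {d : ℕ} {X : Type*}

/-- The configuration equal to `x` on `V` and to `z` off `V` (the concatenation `xz`). -/
def concat (V : Finset (Site d)) (x z : Config d X) : Config d X :=
  fun t => if t ∈ V then x t else z t

/-- The configuration equal to `u` on `I` and to `y` off `I`. -/
def extCfg (I : Finset (Site d)) (u : {s // s ∈ I} → X) (y : Config d X) : Config d X :=
  fun t => if h : t ∈ I then u ⟨t, h⟩ else y t

/-- The cylinder set determined by the values of `z` on `Λ`. -/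
def cyl (Λ : Finset (Site d)) (z : Config d X) : Set (Config d X) :=
  {ω | ∀ t ∈ Λ, ω t = z t}

/-- Finite-dimensional distribution `P_Λ(z)`. -/
def fdd [MeasurableSpace X] (P : Measure (Config d X)) (Λ : Finset (Site d))
    (z : Config d X) : ℝ :=
  (P (cyl Λ z)).toReal

/-- A positive random field: all finite-dimensional distributions are positive. -/
def IsPositiveRF [MeasurableSpace X] (P : Measure (Config d X)) : Prop :=
  ∀ Λ : Finset (Site d), Λ.Nonempty → ∀ z : Config d X, 0 < fdd P Λ z

/-- Finite-conditional probability `g_V^z(x)` with boundary condition `z` on `Λ`. -/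
def gfin [MeasurableSpace X] (P : Measure (Config d X)) (V Λ : Finset (Site d))
    (x z : Config d X) : ℝ :=
  fdd P (V ∪ Λ) (concat V x z) / fdd P Λ z

/-- A filtration: an increasing sequence of finite subsets of the lattice with union `ℤ^d`. -/
structure Filt (d : ℕ) where
  Λ : ℕ → Finset (Site d)
  mono : Monotone Λ
  covers : ∀ t : Site d, ∃ n, t ∈ Λ n

/-- The set `𝒳_V(F)` of admissible boundary conditions: those `x̄` for which all the limits
`lim_n g_V^{x̄_{Λ_n ∖ V}}(x)` exist. (Only the values of `x̄` off `V` are ever used.) -/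
def admissible [MeasurableSpace X] (P : Measure (Config d X)) (V : Finset (Site d))
    (F : Filt d) : Set (Config d X) :=
  {xb | ∀ x : Config d X, ∃ L : ℝ,
    Tendsto (fun n => gfin P V (F.Λ n \ V) x xb) atTop (𝓝 L)}

/-- The conditional probability `g_V^{x̄}(x)` : the limit of `g_V^{x̄_{Λ_n ∖ V}}(x)`. -/
def gCond [MeasurableSpace X] (P : Measure (Config d X)) (V : Finset (Site d))
    (F : Filt d) (xb x : Config d X) : ℝ :=
  limUnder atTop (fun n => gfin P V (F.Λ n \ V) x xb)

/-- Transition energy `Δ_V^{x̄}(x,u) = ln (g_V^{x̄}(x) / g_V^{x̄}(u))`. -/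
def TE [MeasurableSpace X] (P : Measure (Config d X)) (V : Finset (Site d))
    (F : Filt d) (xb x u : Config d X) : ℝ :=
  Real.log (gCond P V F xb x / gCond P V F xb u)

/-- Quasilocality (on boundary conditions off `V`) of a function `h` on a set `Y` of
boundary conditions. -/
def QuasilocalOn (V : Finset (Site d)) (Y : Set (Config d X)) (h : Config d X → ℝ) : Prop :=
  ∀ ε > 0, ∃ Λε : Finset (Site d), Disjoint Λε V ∧
    ∀ Λ : Finset (Site d), Disjoint Λ V → Λε ⊆ Λ →
      ∀ xb ∈ Y, ∀ yb ∈ Y, (∀ s ∈ Λ, xb s = yb s) → |h xb - h yb| < ε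

/-- `Y` represents a set of boundary conditions on `ℤ^d ∖ {t}`: membership does not depend
on the value at `t`. -/
def IsBCSet (t : Site d) (Y : Set (Config d X)) : Prop :=
  ∀ (ω : Config d X) (a : X), ω ∈ Y → Function.update ω t a ∈ Y

/-- `F` is a determining filtration for `P` with sets `Y t` of admissible boundary conditions:
the one-point finite-conditional probabilities converge, uniformly over `Y t`, to positive
limits, and `P(Y t) = 1`. -/
structure IsDetermining [MeasurableSpace X] (P : Measure (Config d X)) (F : Filt d)
    (Y : Site d → Set (Config d X)) : Prop where
  meas : ∀ t, MeasurableSet (Y t)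
  bc : ∀ t, IsBCSet t (Y t)
  adm : ∀ t, Y t ⊆ admissible P {t} F
  full : ∀ t, P (Y t) = 1
  pos : ∀ t, ∀ xb ∈ Y t, ∀ x : X, 0 < gCond P {t} F xb (fun _ => x)
  unif : ∀ (t : Site d) (x : X), ∀ ε > 0, ∃ N, ∀ n ≥ N, ∀ xb ∈ Y t,
    |gfin P {t} (F.Λ n \ {t}) (fun _ => x) xb - gCond P {t} F xb (fun _ => x)| < ε

/-- The probabilistic (Pr--) definition of a Gibbs random field. -/
def IsGibbsRF [MeasurableSpace X] (P : Measure (Config d X)) : Prop :=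
  IsProbabilityMeasure P ∧ IsPositiveRF P ∧
    ∃ (F : Filt d) (Y : Site d → Set (Config d X)), IsDetermining P F Y

section Auxiliary

lemma cyl_congr {Λ : Finset (Site d)} {z z' : Config d X} (h : ∀ s ∈ Λ, z s = z' s) :
    cyl Λ z = cyl Λ z' := by
  ext ω
  exact forall₂_congr fun s hs => by rw [h s hs]

variable [MeasurableSpace X]

lemma gfin_congr (P : Measure (Config d X)) {V Λ : Finset (Site d)} {x x' z z' : Config d X}
    (hx : ∀ s ∈ V, x s = x' s) (hz : ∀ s ∈ Λ, z s = z' s) :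
    gfin P V Λ x z = gfin P V Λ x' z' := by
  have h : ∀ s ∈ V ∪ Λ, concat V x z s = concat V x' z' s := by
    intro s hs
    by_cases hV : s ∈ V
    · simp [concat, hV, hx s hV]
    · simp [concat, hV, hz s ((Finset.mem_union.mp hs).resolve_left hV)]
  simp only [gfin, fdd, cyl_congr h, cyl_congr hz]

lemma measurableSet_cyl [MeasurableSingletonClass X] (Λ : Finset (Site d)) (z : Config d X) :
    MeasurableSet (cyl Λ z) := by
  have h : cyl Λ z = ⋂ s ∈ Λ, (fun ω : Config d X => ω s) ⁻¹' {z s} := by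
    ext ω
    simp [cyl]
  rw [h]
  exact Finset.measurableSet_biInter _ fun s _ => measurable_pi_apply s (measurableSet_singleton _)

lemma fdd_pos (P : Measure (Config d X)) [IsProbabilityMeasure P] (hP : IsPositiveRF P)
    (Λ : Finset (Site d)) (z : Config d X) : 0 < fdd P Λ z := by
  rcases Λ.eq_empty_or_nonempty with rfl | h
  · simp [fdd, cyl]
  · exact hP Λ h z

/-- Consistency of the finite-dimensional distributions when one site is added. -/
lemma fdd_eq_sum_insert [Fintype X] [MeasurableSingletonClass X] (P : Measure (Config d X))
    [IsProbabilityMeasure P] {Λ : Finset (Site d)} {s : Site d} (hs : s ∉ Λ) (z : Config d X) :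
    fdd P Λ z = ∑ a : X, fdd P (insert s Λ) (Function.update z s a) := by
  have hmem : ∀ (a : X) (ω : Config d X),
      ω ∈ cyl (insert s Λ) (Function.update z s a) ↔ ω s = a ∧ ω ∈ cyl Λ z := by
    intro a ω
    simp only [cyl, Set.mem_ofPred_eq, Finset.forall_mem_insert, Function.update_self]
    refine and_congr_right fun _ => forall₂_congr fun u hu => ?_
    rw [Function.update_of_ne (ne_of_mem_of_not_mem hu hs)]
  have hunion : cyl Λ z = ⋃ a : X, cyl (insert s Λ) (Function.update z s a) := by
    ext ω
    simp [hmem]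
  have hdisj : Pairwise
      (Function.onFun Disjoint fun a : X => cyl (insert s Λ) (Function.update z s a)) := by
    intro a b hab
    refine Set.disjoint_left.mpr fun ω ha hb => hab ?_
    exact ((hmem a ω).mp ha).1.symm.trans ((hmem b ω).mp hb).1
  unfold fdd
  rw [hunion, measure_iUnion hdisj fun a => measurableSet_cyl _ _, tsum_fintype,
    ENNReal.toReal_sum fun a _ => measure_ne_top P _]

lemma abs_gfin_sub_le_iff (P : Measure (Config d X)) [IsProbabilityMeasure P]
    (hP : IsPositiveRF P) (V Λ : Finset (Site d)) (x z : Config d X) (c δ : ℝ) :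
    |gfin P V Λ x z - c| ≤ δ ↔
      |fdd P (V ∪ Λ) (concat V x z) - c * fdd P Λ z| ≤ δ * fdd P Λ z := by
  have h := fdd_pos P hP Λ z
  have e : gfin P V Λ x z - c = (fdd P (V ∪ Λ) (concat V x z) - c * fdd P Λ z) / fdd P Λ z := by
    unfold gfin
    field_simp
  rw [e, abs_div, abs_of_pos h, div_le_iff₀ h]

/-- A finite-conditional probability is an average of those with one more boundary site. -/
lemma abs_gfin_sub_le_of_insert [Fintype X] [MeasurableSingletonClass X]
    (P : Measure (Config d X)) [IsProbabilityMeasure P] (hP : IsPositiveRF P)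
    {V Λ : Finset (Site d)} {s : Site d} (hsV : s ∉ V) (hsΛ : s ∉ Λ) (x z : Config d X)
    (c δ : ℝ) (h : ∀ a : X, |gfin P V (insert s Λ) x (Function.update z s a) - c| ≤ δ) :
    |gfin P V Λ x z - c| ≤ δ := by
  have hcon : ∀ a : X, concat V x (Function.update z s a)
      = Function.update (concat V x z) s a := by
    intro a
    funext u
    by_cases hu : u = s
    · subst hu
      simp [concat, hsV]
    · simp [concat, hu]
  simp only [abs_gfin_sub_le_iff P hP, hcon, Finset.union_insert] at h ⊢
  rw [fdd_eq_sum_insert P hsΛ z, fdd_eq_sum_insert P (s := s) (Λ := V ∪ Λ) (by simp [hsV, hsΛ]),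
    Finset.mul_sum, Finset.mul_sum, ← Finset.sum_sub_distrib]
  exact (Finset.abs_sum_le_sum_abs _ _).trans (Finset.sum_le_sum fun a _ => h a)

lemma abs_gfin_sub_le_of_union [Fintype X] [MeasurableSingletonClass X]
    (P : Measure (Config d X)) [IsProbabilityMeasure P] (hP : IsPositiveRF P)
    {V : Finset (Site d)} (x : Config d X) (c δ : ℝ) (D : Finset (Site d)) :
    ∀ (Λ : Finset (Site d)) (z : Config d X), Disjoint D V →
      (∀ z' : Config d X, (∀ s ∈ Λ, z' s = z s) → |gfin P V (D ∪ Λ) x z' - c| ≤ δ) →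
      |gfin P V Λ x z - c| ≤ δ := by
  induction D using Finset.induction_on with
  | empty =>
    intro Λ z _ h
    simpa using h z fun _ _ => rfl
  | insert s D _ ih =>
    intro Λ z hD h
    rw [Finset.disjoint_insert_left] at hD
    by_cases hs : s ∈ Λ
    · refine ih Λ z hD.2 fun z' hz' => ?_
      have := h z' hz'
      rwa [Finset.insert_union, Finset.insert_eq_of_mem (Finset.mem_union_right _ hs)] at this
    · refine abs_gfin_sub_le_of_insert P hP hD.1 hs x z c δ fun a => ?_
      refine ih (insert s Λ) _ hD.2 fun z' hz' => ?_
      have := h z' fun u hu => by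
        rw [hz' u (Finset.mem_insert_of_mem hu),
          Function.update_of_ne (ne_of_mem_of_not_mem hu hs)]
      rwa [Finset.insert_union, ← Finset.union_insert] at this

lemma Filt.exists_subset (F : Filt d) (S : Finset (Site d)) (N : ℕ) :
    ∃ n ≥ N, S ⊆ F.Λ n := by
  choose k hk using F.covers
  refine ⟨max N (S.sup k), le_max_left _ _, fun s hs => ?_⟩
  exact F.mono ((Finset.le_sup hs).trans (le_max_right _ _)) (hk s)

lemma exists_mem_cyl (P : Measure (Config d X)) [IsProbabilityMeasure P] (hP : IsPositiveRF P)
    {Y : Set (Config d X)} (hY : MeasurableSet Y) (hPY : P Y = 1) (Λ : Finset (Site d))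
    (z : Config d X) : ∃ y ∈ Y, ∀ s ∈ Λ, y s = z s := by
  by_contra! h
  have hsub : cyl Λ z ⊆ Yᶜ := fun ω hω hωY => by
    obtain ⟨s, hs, hne⟩ := h ω hωY
    exact hne (hω s hs)
  have h0 : P (cyl Λ z) = 0 :=
    measure_mono_null hsub ((prob_compl_eq_zero_iff hY).mpr hPY)
  have := fdd_pos P hP Λ z
  simp [fdd, h0] at this

/-- Along a determining filtration the convergence is uniform over all sufficiently large
finite sets of boundary sites. -/
lemma IsDetermining.exists_forall_abs_gfin_sub_lt [Fintype X] [MeasurableSingletonClass X]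
    {P : Measure (Config d X)} [IsProbabilityMeasure P] (hP : IsPositiveRF P)
    {F : Filt d} {Y : Site d → Set (Config d X)} (hF : IsDetermining P F Y) (t : Site d) (x : X)
    {ε : ℝ} (hε : 0 < ε) :
    ∃ S : Finset (Site d), ∀ Λ : Finset (Site d), S ⊆ Λ → ∀ xb ∈ Y t,
      |gfin P {t} (Λ \ {t}) (fun _ => x) xb - gCond P {t} F xb (fun _ => x)| < ε := by
  obtain ⟨N, hN⟩ := hF.unif t x (ε / 4) (by positivity)
  refine ⟨F.Λ N, fun Λ hΛ xb hxb => ?_⟩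
  obtain ⟨M, hM, hΛM⟩ := F.exists_subset Λ N
  have hclose : |gfin P {t} (Λ \ {t}) (fun _ => x) xb
      - gfin P {t} (F.Λ N \ {t}) (fun _ => x) xb| ≤ ε / 2 := by
    refine abs_gfin_sub_le_of_union P hP _ _ _ (F.Λ M \ {t}) _ xb
      Finset.sdiff_disjoint fun z hz => ?_
    rw [Finset.union_eq_left.mpr (Finset.sdiff_subset_sdiff hΛM subset_rfl)]
    obtain ⟨y, hy, hyz⟩ := exists_mem_cyl P hP (hF.meas t) (hF.full t) (F.Λ M \ {t}) z
    have e₁ := gfin_congr P (V := {t}) (x := fun _ => x) (fun _ _ => rfl) hyz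
    have e₂ : gfin P {t} (F.Λ N \ {t}) (fun _ => x) y
        = gfin P {t} (F.Λ N \ {t}) (fun _ => x) xb := by
      refine gfin_congr P (fun _ _ => rfl) fun s hs => ?_
      have hs' : s ∈ Λ \ {t} := Finset.sdiff_subset_sdiff hΛ subset_rfl hs
      rw [hyz s (Finset.sdiff_subset_sdiff hΛM subset_rfl hs'), hz s hs']
    have h₁ := abs_lt.mp (hN M hM y hy)
    have h₂ := abs_lt.mp (hN N le_rfl y hy)
    rw [← e₁, ← e₂, abs_le]
    constructor <;> linarith
  have h₁ := abs_le.mp hclose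
  have h₂ := abs_lt.mp (hN N le_rfl xb hxb)
  rw [abs_lt]
  constructor <;> linarith

end Auxiliary

/-- Proposition 3 / `prop-Yt`: universal sets of boundary conditions,
uniform convergence along every filtration to a filtration-independent positive limit. -/
theorem stmt10 [Fintype X] [Nontrivial X] [MeasurableSpace X] [MeasurableSingletonClass X]
    (P : Measure (Config d X)) (hP : IsGibbsRF P) :
    ∀ t : Site d, ∃ Y : Set (Config d X),
      MeasurableSet Y ∧ IsBCSet t Y ∧ P Y = 1 ∧
      ∃ g : Config d X → X → ℝ,
        (∀ xb ∈ Y, ∀ x : X, 0 < g xb x) ∧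
        ∀ F' : Filt d,
          Y ⊆ admissible P {t} F' ∧
          (∀ xb ∈ Y, ∀ x : X, gCond P {t} F' xb (fun _ => x) = g xb x) ∧
          (∀ x : X, ∀ ε > 0, ∃ N, ∀ n ≥ N, ∀ xb ∈ Y,
            |gfin P {t} (F'.Λ n \ {t}) (fun _ => x) xb - g xb x| < ε) := by
  obtain ⟨hprob, hpos, F, Y, hF⟩ := hP
  intro t
  refine ⟨Y t, hF.meas t, hF.bc t, hF.full t, fun xb x => gCond P {t} F xb (fun _ => x),
    hF.pos t, fun F' => ?_⟩
  have hunif : ∀ x : X, ∀ ε > 0, ∃ N, ∀ n ≥ N, ∀ xb ∈ Y t,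
      |gfin P {t} (F'.Λ n \ {t}) (fun _ => x) xb - gCond P {t} F xb (fun _ => x)| < ε := by
    intro x ε hε
    obtain ⟨S, hS⟩ := hF.exists_forall_abs_gfin_sub_lt hpos t x hε
    obtain ⟨N, -, hN⟩ := F'.exists_subset S 0
    exact ⟨N, fun n hn => hS _ (hN.trans (F'.mono hn))⟩
  have hlim : ∀ xb ∈ Y t, ∀ x : X, Tendsto
      (fun n => gfin P {t} (F'.Λ n \ {t}) (fun _ => x) xb) atTop
      (𝓝 (gCond P {t} F xb (fun _ => x))) := by
    intro xb hxb x
    refine Metric.tendsto_atTop.mpr fun ε hε => ?_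
    obtain ⟨N, hN⟩ := hunif x ε hε
    exact ⟨N, fun n hn => hN n hn xb hxb⟩
  refine ⟨fun xb hxb x => ⟨_, (hlim xb hxb (x t)).congr fun n => ?_⟩,
    fun xb hxb x => (hlim xb hxb x).limUnder_eq, hunif⟩
  exact gfin_congr P (by simp) fun _ _ => rfl
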